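/- Let G(n) be the adjacency matrix of the path graph on n = 2m+1 vertices and let δ ∈ [1/2, 1]. Then the strategy profile x with x_i = 1 for odd i and x_i = 0 for even i (vertices indexed 1,…,n) is a fixed point of the best-response map: for every i, x_i = max(0, 1 − δ Σ_j g_{ij} x_j). In particular, for 1/2 ≤ δ < 1/|λ_min(G(n))| this alternating profile is the unique Nash equilibrium, and its set of active agents has configuration 1−1−⋯−1. -/

import Mathlib

open Matrix Finset Real

/-- Adjacency matrix of the path graph on `n` vertices:
`g i j = 1` iff `|i − j| = 1`. -/
def pathAdj (n : ℕ) : Matrix (Fin n) (Fin n) ℝ :=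
  Matrix.of fun i j => if (i : ℕ) + 1 = (j : ℕ) ∨ (j : ℕ) + 1 = (i : ℕ) then 1 else 0

/-- The neighbour sum on the path, for a function vanishing just beyond both ends. -/
lemma pathAdj_sum_mul (n : ℕ) (F : ℕ → ℝ) (h0 : F 0 = 0) (hn : F (n + 1) = 0) (i : Fin n) :
    ∑ j, pathAdj n i j * F (j + 1) = F i + F (i + 2) := by
  obtain ⟨i, hi⟩ := i
  have hsplit : ∀ j : Fin n, pathAdj n ⟨i, hi⟩ j * F (j + 1) =
      (if i + 1 = (j : ℕ) then F (j + 1) else 0) + (if (j : ℕ) + 1 = i then F (j + 1) else 0) := by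
    intro j
    simp only [pathAdj, Matrix.of_apply]
    by_cases h1 : i + 1 = (j : ℕ)
    · have h2 : ¬ (j : ℕ) + 1 = i := by omega
      simp [h1, h2]
    · simp [h1]
  rw [Finset.sum_congr rfl fun j _ => hsplit j, Finset.sum_add_distrib,
    Fin.sum_univ_eq_sum_range (fun j => if i + 1 = j then F (j + 1) else 0) n,
    Fin.sum_univ_eq_sum_range (fun j => if j + 1 = i then F (j + 1) else 0) n,
    Finset.sum_ite_eq, add_comm]
  congr 1
  · cases i with
    | zero => simp [h0]
    | succ k =>
      simp only [add_left_inj, Finset.sum_ite_eq', Finset.mem_range]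
      rw [if_pos (by omega)]
  · split_ifs with h
    · rfl
    · have : n = i + 1 := by simp at h; omega
      subst this
      exact hn.symm

lemma pathAdj_nonneg (n : ℕ) (i j : Fin n) : 0 ≤ pathAdj n i j := by
  simp only [pathAdj, Matrix.of_apply]
  split_ifs <;> norm_num

/-- The vector `sin (iπ/(n+1))` is an eigenvector of the path for `2 cos (π/(n+1))`. -/
lemma pathAdj_sum_mul_sin (n : ℕ) (i : Fin n) :
    ∑ j, pathAdj n i j * Real.sin (((j + 1 : ℕ) : ℝ) * (Real.pi / (n + 1))) =
      2 * Real.cos (Real.pi / (n + 1)) * Real.sin (((i + 1 : ℕ) : ℝ) * (Real.pi / (n + 1))) := by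
  have hn : ((n + 1 : ℕ) : ℝ) * (Real.pi / (n + 1)) = Real.pi := by
    push_cast
    field_simp
  rw [pathAdj_sum_mul n (fun k => Real.sin ((k : ℝ) * (Real.pi / (n + 1)))) (by simp)
    (by simp only [hn, Real.sin_pi])]
  set θ := Real.pi / ((n : ℝ) + 1)
  have e1 : ((i : ℕ) : ℝ) * θ = ((i + 1 : ℕ) : ℝ) * θ - θ := by push_cast; ring
  have e2 : ((i + 2 : ℕ) : ℝ) * θ = ((i + 1 : ℕ) : ℝ) * θ + θ := by push_cast; ring
  rw [e1, e2, Real.sin_sub, Real.sin_add]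
  ring

/-- If `A` is entrywise nonnegative with a positive vector `s` such that `A s = c s` and `δ c < 1`,
then the best-response map has at most one fixed point. -/
lemma bestResponse_fixedPoint_unique {ι : Type*} [Fintype ι] (A : Matrix ι ι ℝ)
    (hA : ∀ i j, 0 ≤ A i j) (s : ι → ℝ) (hs : ∀ i, 0 < s i) (c δ : ℝ) (hδ : 0 ≤ δ)
    (hAs : ∀ i, ∑ j, A i j * s j = c * s i) (hc : δ * c < 1) (x y : ι → ℝ)
    (hx : ∀ i, x i = max 0 (1 - δ * ∑ j, A i j * x j))
    (hy : ∀ i, y i = max 0 (1 - δ * ∑ j, A i j * y j)) : y = x := by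
  cases isEmpty_or_nonempty ι
  · exact Subsingleton.elim _ _
  obtain ⟨k, hk⟩ := Finite.exists_max fun i => |y i - x i| / s i
  set M := |y k - x k| / s k with hM
  have hle : ∀ i, |y i - x i| ≤ M * s i := fun i => (div_le_iff₀ (hs i)).mp (hk i)
  have hMk : |y k - x k| = M * s k := by rw [hM, div_mul_cancel₀ _ (hs k).ne']
  have hM0 : 0 ≤ M := div_nonneg (abs_nonneg _) (hs k).le
  have hsum : |∑ j, A k j * y j - ∑ j, A k j * x j| ≤ M * (c * s k) := by
    rw [← Finset.sum_sub_distrib, ← hAs k, Finset.mul_sum]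
    refine (Finset.abs_sum_le_sum_abs _ _).trans (Finset.sum_le_sum fun j _ => ?_)
    rw [← mul_sub, abs_mul, abs_of_nonneg (hA k j), mul_left_comm]
    exact mul_le_mul_of_nonneg_left (hle j) (hA k j)
  have hcontr : M * s k ≤ δ * (M * (c * s k)) := by
    rw [← hMk]
    calc |y k - x k|
        ≤ |(1 - δ * ∑ j, A k j * y j) - (1 - δ * ∑ j, A k j * x j)| := by
          rw [hx k, hy k]
          simpa only [max_comm] using abs_max_sub_max_le_abs
            (1 - δ * ∑ j, A k j * y j) (1 - δ * ∑ j, A k j * x j) 0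
      _ = δ * |∑ j, A k j * y j - ∑ j, A k j * x j| := by
          rw [sub_sub_sub_cancel_left, ← mul_sub, abs_mul, abs_of_nonneg hδ, abs_sub_comm]
      _ ≤ δ * (M * (c * s k)) := mul_le_mul_of_nonneg_left hsum hδ
  have hM_zero : M = 0 := by
    by_contra hne
    have hpos : 0 < M * s k := mul_pos (lt_of_le_of_ne hM0 (Ne.symm hne)) (hs k)
    nlinarith [mul_pos hpos (sub_pos.mpr hc)]
  funext i
  have := hle i
  rw [hM_zero, zero_mul] at this
  exact sub_eq_zero.mp (abs_nonpos_iff.mp this)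

/-- on the odd path with `n = 2m+1` vertices (0-indexed here, so
1-based odd vertices are the even indices), for `δ ∈ [1/2, 1]` the alternating
profile `x = (1,0,1,0,…,1)` is a fixed point of the best-response map; and for
`1/2 ≤ δ < 1/|λ_min(G(n))| = 1/|2cos(nπ/(n+1))|` it is the unique Nash
equilibrium (its active set has configuration `1−1−⋯−1`). -/
theorem oddPath_alternating_equilibrium
    (m : ℕ) (δ : ℝ) (hδ : δ ∈ Set.Icc (1/2 : ℝ) 1)
    (x : Fin (2*m+1) → ℝ)
    (hx : ∀ i, x i = if (i : ℕ) % 2 = 0 then 1 else 0) :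
    (∀ i, x i = max 0 (1 - δ * ∑ j, pathAdj (2*m+1) i j * x j)) ∧
    (δ < 1 / |2 * Real.cos ((2*m+1) * Real.pi / (2*m+2))| →
      ∀ y : Fin (2*m+1) → ℝ,
        (∀ i, y i ∈ Set.Icc (0 : ℝ) 1) →
        (∀ i, y i = max 0 (1 - δ * ∑ j, pathAdj (2*m+1) i j * y j)) →
        y = x) := by
  have hfix : ∀ i, x i = max 0 (1 - δ * ∑ j, pathAdj (2*m+1) i j * x j) := by
    intro i
    have hF : ∀ j, x j = (fun k : ℕ => if k % 2 = 1 then (1 : ℝ) else 0) (j + 1) := by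
      intro j
      rw [hx j]
      exact if_congr (by omega) rfl rfl
    have hsum : ∑ j, pathAdj (2*m+1) i j * x j = if (i : ℕ) % 2 = 1 then 2 else 0 := by
      rw [Finset.sum_congr rfl fun j _ => by rw [hF j],
        pathAdj_sum_mul (2*m+1) (fun k : ℕ => if k % 2 = 1 then (1 : ℝ) else 0) (by simp)
          (if_neg (by omega))]
      by_cases h : (i : ℕ) % 2 = 1
      · simp [h]
        norm_num
      · simp [h]
    rw [hsum, hx i]
    rcases Nat.mod_two_eq_zero_or_one (i : ℕ) with h | h
    · simp [h]
    · rw [h, if_neg one_ne_zero, if_pos rfl, max_eq_left]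
      linarith [hδ.1]
  refine ⟨hfix, fun hlt y _ hy => ?_⟩
  have hangle : (2*m+1) * Real.pi / (2*m+2) = Real.pi - Real.pi / (((2*m+1 : ℕ) : ℝ) + 1) := by
    push_cast
    field_simp
    ring
  set c := 2 * Real.cos (Real.pi / (((2*m+1 : ℕ) : ℝ) + 1)) with hc
  rw [hangle, Real.cos_pi_sub, mul_neg, abs_neg, ← hc] at hlt
  have hδ0 : 0 < δ := by linarith [hδ.1]
  have hcpos : 0 < |c| := one_div_pos.mp (hδ0.trans hlt)
  have hδc : δ * c < 1 :=
    (mul_le_mul_of_nonneg_left (le_abs_self c) hδ0.le).trans_lt ((lt_div_iff₀ hcpos).mp hlt)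
  refine bestResponse_fixedPoint_unique _ (pathAdj_nonneg _)
    (fun i => Real.sin (((i + 1 : ℕ) : ℝ) * (Real.pi / (((2*m+1 : ℕ) : ℝ) + 1)))) (fun i => ?_)
    c δ hδ0.le (pathAdj_sum_mul_sin (2*m+1)) hδc x y hfix hy
  apply Real.sin_pos_of_pos_of_lt_pi
  · positivity
  · have hi : ((i + 1 : ℕ) : ℝ) < ((2*m+1 : ℕ) : ℝ) + 1 := by exact_mod_cast Nat.succ_lt_succ i.2
    rw [← mul_div_assoc, div_lt_iff₀ (by positivity), mul_comm]
    exact mul_lt_mul_of_pos_left hi Real.pi_pos
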